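/- arXiv:1111.2508 — 8 statements merged into one kernel-verified Lean document; each statement's English description precedes it below -/
import Mathlib

section
/- Let W be the loop polynomial W = Σ_{i=1}^N X_i^{a_i} X_{i+1} (indices mod N). There exists a nonzero complex number c such that, in the Milnor ring Q_W, the image of the Hessian determinant hess(W) equals c times the image of the monomial ∏_{i=1}^N X_i^{a_i − 1}. -/
open MvPolynomial

/-- The loop polynomial `W = ∑ i, X i ^ a i * X (i+1)` (indices mod `N`). -/
noncomputable def loopW (N : ℕ) [NeZero N] (a : Fin N → ℕ) : MvPolynomial (Fin N) ℂ :=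
  ∑ i : Fin N, X i ^ a i * X (i + 1)

/-- The Jacobian ideal of `W`, generated by the partial derivatives. -/
noncomputable def jacIdeal {N : ℕ} (W : MvPolynomial (Fin N) ℂ) :
    Ideal (MvPolynomial (Fin N) ℂ) :=
  Ideal.span (Set.range fun i => pderiv i W)

/-- The Milnor ring `Q_W = ℂ[X]/Jac(W)`. -/
abbrev MilnorRing {N : ℕ} (W : MvPolynomial (Fin N) ℂ) :=
  MvPolynomial (Fin N) ℂ ⧸ jacIdeal W

/-- The Hessian determinant `hess W = det (∂²W/∂X i ∂X j)`. -/
noncomputable def hess {N : ℕ} (W : MvPolynomial (Fin N) ℂ) : MvPolynomial (Fin N) ℂ :=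
  Matrix.det (Matrix.of fun i j => pderiv i (pderiv j W))

/-- If `σ` is an involution, two products agree as soon as the factors agree at the fixed points
and the products of the factors agree along each orbit. -/
lemma prod_eq_prod_of_involutive {ι R : Type*} [Fintype ι] [LinearOrder ι] [CommMonoid R]
    (σ : ι → ι) (hσ : Function.Involutive σ) (F G : ι → R)
    (hfix : ∀ i, σ i = i → F i = G i)
    (hpair : ∀ i, i < σ i → F i * F (σ i) = G i * G (σ i)) :
    ∏ i, F i = ∏ i, G i := by
  have key : ∀ K : ι → R, ∏ i, K i =
      (∏ i with i < σ i, K i * K (σ i)) * ∏ i with σ i = i, K i := by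
    intro K
    have h1 : ∏ i with ¬ i < σ i, K i =
        (∏ i with σ i < i, K i) * ∏ i with σ i = i, K i := by
      rw [← Finset.prod_filter_mul_prod_filter_not
        (Finset.univ.filter fun i => ¬ i < σ i) (fun i => σ i < i)]
      congr 1
      · refine Finset.prod_congr ?_ fun _ _ => rfl
        ext i
        simp only [Finset.mem_filter, Finset.mem_univ, true_and]
        exact ⟨fun h => h.2, fun h => ⟨h.le.not_gt, h⟩⟩
      · refine Finset.prod_congr ?_ fun _ _ => rfl
        ext i
        simp only [Finset.mem_filter, Finset.mem_univ, true_and, not_lt]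
        exact ⟨fun h => le_antisymm h.1 h.2, fun h => ⟨h.le, h.ge⟩⟩
    have h2 : ∏ i with σ i < i, K i = ∏ i with i < σ i, K (σ i) := by
      refine Finset.prod_nbij' σ σ ?_ ?_ ?_ ?_ ?_
      · intro i; simp [hσ i]
      · intro i; simp [hσ i]
      · intro i _; exact hσ i
      · intro i _; exact hσ i
      · intro i _; rw [hσ i]
    rw [← Finset.prod_filter_mul_prod_filter_not Finset.univ (fun i => i < σ i), h1, h2,
      Finset.prod_mul_distrib, mul_assoc]
  rw [key F, key G]
  congr 1
  · exact Finset.prod_congr rfl fun i hi => hpair i (by simpa using hi)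
  · exact Finset.prod_congr rfl fun i hi => hfix i (by simpa using hi)

/-- In a cyclic group in which `1` and `2` are nonzero, a permutation moving each point by at most
one step is a rotation or an involution. -/
lemma eq_rotation_or_involutive {N : ℕ} [NeZero N] (h1 : (1 : Fin N) ≠ 0)
    (h2 : (1 + 1 : Fin N) ≠ 0) (σ : Equiv.Perm (Fin N))
    (hσ : ∀ i, σ i = i ∨ σ i = i + 1 ∨ σ i = i - 1) :
    (∀ i, σ i = i + 1) ∨ (∀ i, σ i = i - 1) ∨ Function.Involutive σ := by
  have cyclic_induction : ∀ (P : Fin N → Prop) (i : Fin N),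
      P i → (∀ j, P j → P (j + 1)) → ∀ j, P j := by
    intro P i hi hs j
    have : ∀ n : ℕ, P (i + n • (1 : Fin N)) := by
      intro n
      induction n with
      | zero => simpa using hi
      | succ n ih => rw [succ_nsmul, ← add_assoc]; exact hs _ ih
    have h := this (j - i).val
    have e : (j - i).val • (1 : Fin N) = j - i := by
      open Fin.NatCast Fin.CommRing in
      rw [nsmul_one]; exact Fin.cast_val_eq_self _
    rw [e] at h
    simpa using h
  by_cases hinv : Function.Involutive σ
  · exact Or.inr (Or.inr hinv)
  simp only [Function.Involutive, not_forall] at hinv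
  obtain ⟨i, hi⟩ := hinv
  have ne1 : ∀ j : Fin N, j + 1 ≠ j := fun j h => h1 (by simpa using h)
  have ne2 : ∀ j : Fin N, j + 1 + 1 ≠ j := fun j h => h2 (by
    have : j + (1 + 1) = j := by rw [← add_assoc]; exact h
    simpa using this)
  have next : ∀ j, (σ j = j + 1 ∧ σ (j + 1) ≠ j) →
      σ (j + 1) = j + 1 + 1 ∧ σ (j + 1 + 1) ≠ j + 1 := by
    rintro j ⟨hj, hj'⟩
    have hn : σ (j + 1) ≠ j + 1 := fun h => ne1 j (σ.injective (h.trans hj.symm))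
    rcases hσ (j + 1) with h | h | h
    · exact absurd h hn
    · exact ⟨h, fun h' => ne2 j (σ.injective (h'.trans hj.symm))⟩
    · exact absurd (by simpa using h) hj'
  have prev : ∀ j, (σ j = j - 1 ∧ σ (j - 1) ≠ j) →
      σ (j + 1) = j + 1 - 1 ∧ σ (j + 1 - 1) ≠ j + 1 := by
    rintro j ⟨hj, hj'⟩
    obtain ⟨k, hk⟩ := σ.surjective j
    have hkj : k = j + 1 := by
      rcases hσ k with h | h | h
      · have : k = j := h.symm.trans hk
        subst this
        rw [hk] at hj
        exact absurd (by rw [← hj]) (fun h : k - 1 = k => ne1 k (by conv_lhs => rw [← h]; simp))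
      · have : k = j - 1 := by rw [← hk, h]; simp
        rw [← this] at hj'
        exact absurd hk hj'
      · rw [← hk, h]; simp
    subst hkj
    refine ⟨by rw [hk]; simp, ?_⟩
    have : j + 1 - 1 = j := by simp
    rw [this, hj]
    intro h
    exact ne2 j (by rw [← h]; simp)
  rcases hσ i with h | h | h
  · rw [h, h] at hi; exact absurd rfl hi
  · rw [h] at hi
    exact Or.inl fun j =>
      (cyclic_induction (fun j => σ j = j + 1 ∧ σ (j + 1) ≠ j) i ⟨h, hi⟩ next j).1
  · rw [h] at hi
    exact Or.inr (Or.inl fun j =>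
      (cyclic_induction (fun j => σ j = j - 1 ∧ σ (j - 1) ≠ j) i ⟨h, hi⟩ prev j).1)

/-- The integer matrix that records the Hessian of the loop polynomial after the Jacobian relations
have been used to write each entry as a multiple of a monomial. -/
def loopCoeff {N : ℕ} [NeZero N] (a : Fin N → ℕ) : Matrix (Fin N) (Fin N) ℤ :=
  Matrix.of fun j i => (a i : ℤ) *
    ((if j = i then (a i : ℤ) - 1 else 0) + (if j = i + 1 then 1 else 0)
      - (if j = i - 1 then (a j : ℤ) else 0))

lemma det_loopCoeff {N : ℕ} [NeZero N] (a : Fin N → ℕ) : (loopCoeff a).det = 0 := by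
  rw [loopCoeff]
  erw [Matrix.det_mul_row (fun i => (a i : ℤ)) (Matrix.of fun j i : Fin N =>
    ((if j = i then (a i : ℤ) - 1 else 0) + (if j = i + 1 then 1 else 0)
      - (if j = i - 1 then (a j : ℤ) else 0)))]
  refine mul_eq_zero_of_right _ (Matrix.exists_mulVec_eq_zero_iff.mp ⟨1, one_ne_zero, ?_⟩)
  ext j
  have e1 : ∀ i, j = i + 1 ↔ j - 1 = i := fun i => sub_eq_iff_eq_add.symm
  have e2 : ∀ i, j = i - 1 ↔ j + 1 = i := fun i => eq_sub_iff_add_eq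
  simp [Matrix.mulVec, dotProduct, Finset.sum_sub_distrib, Finset.sum_add_distrib, e1, e2]

/-- The determinant of a matrix with the shape of the Hessian of the loop polynomial, in a ring
where the Jacobian relations hold. -/
lemma det_eq_of_jacobian_relations {N : ℕ} [NeZero N] (hN : 3 ≤ N) (a : Fin N → ℕ)
    (ha : ∀ i, 2 ≤ a i) {R : Type*} [CommRing R] (x : Fin N → R)
    (hx : ∀ i, a (i + 1) * x (i + 1) ^ (a (i + 1) - 1) * x (i + 1 + 1) + x i ^ a i = 0)
    (M : Matrix (Fin N) (Fin N) R)
    (hM : ∀ j i, M j i = a i * ((a i - 1) * x i ^ (a i - 2) * x (i + 1) * (if j = i then 1 else 0)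
        + x i ^ (a i - 1) * (if j = i + 1 then 1 else 0))
      + a (i - 1) * x (i - 1) ^ (a (i - 1) - 1) * (if j = i - 1 then 1 else 0)) :
    ∃ c : ℤ, c ≠ 0 ∧ M.det = c * ∏ i, x i ^ (a i - 1) := by
  have h1 : (1 : Fin N) ≠ 0 := by
    obtain ⟨n, rfl⟩ : ∃ n, N = n + 3 := ⟨N - 3, by omega⟩
    simp
  have h2 : (1 + 1 : Fin N) ≠ 0 := by
    obtain ⟨n, rfl⟩ : ∃ n, N = n + 3 := ⟨N - 3, by omega⟩
    simp [Fin.ext_iff, Fin.val_add, Nat.mod_eq_of_lt (show 2 < n + 3 by omega)]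
  have ne1 : ∀ j : Fin N, j + 1 ≠ j := fun j h => h1 (by simpa using h)
  have ne1' : ∀ j : Fin N, j - 1 ≠ j := fun j h => h1 (by simpa using h)
  have ne2 : ∀ j : Fin N, j + 1 ≠ j - 1 := fun j h => h2 (by
    rw [eq_sub_iff_add_eq, add_assoc] at h
    simpa using h)
  set m := ∏ i, x i ^ (a i - 1) with hm
  set d : Fin N → R := fun i => x i ^ (a i - 2) * x (i + 1) with hd
  have hdm : ∏ i, d i = m := by
    have e : ∏ i, x (i + 1) = ∏ i, x i := Equiv.prod_comp (Equiv.addRight (1 : Fin N)) x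
    simp only [hd, hm]
    rw [Finset.prod_mul_distrib, e, ← Finset.prod_mul_distrib]
    refine Finset.prod_congr rfl fun i _ => ?_
    rw [← pow_succ]
    congr 1
    have := ha i
    omega
  have Mdiag : ∀ i, M i i = (loopCoeff a i i : R) * d i := by
    intro i
    simp [hM, loopCoeff, hd, (ne1 i).symm, (ne1' i).symm]
    ring
  have Mup : ∀ i, M (i + 1) i = a i * x i ^ (a i - 1) := by
    intro i; simp [hM, ne1, ne2]
  have Mdown : ∀ i, M (i - 1) i = a (i - 1) * x (i - 1) ^ (a (i - 1) - 1) := by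
    intro i; simp [hM, ne1', (ne2 _).symm]
  have Cup : ∀ i, loopCoeff a (i + 1) i = a i := by
    intro i; simp [loopCoeff, ne1, ne2]
  have Cdown : ∀ i, loopCoeff a (i - 1) i = - (a i * a (i - 1)) := by
    intro i; simp [loopCoeff, ne1', (ne2 _).symm]
  have pair : ∀ i, M (i + 1) i * M i (i + 1) =
      ((loopCoeff a (i + 1) i : R) * d i) * ((loopCoeff a i (i + 1) : R) * d (i + 1)) := by
    intro i
    have e : i + 1 - 1 = i := by simp
    have m2 := Mdown (i + 1)
    have c2 := Cdown (i + 1)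
    rw [e] at m2 c2
    rw [Mup, m2, Cup, c2]
    simp only [hd]
    have hxi := hx i
    obtain ⟨p, hp⟩ : ∃ p, a i = p + 2 := ⟨a i - 2, by have := ha i; omega⟩
    obtain ⟨q, hq⟩ : ∃ q, a (i + 1) = q + 2 := ⟨a (i + 1) - 2, by have := ha (i + 1); omega⟩
    rw [hp, hq] at hxi ⊢
    simp only [Nat.add_sub_cancel, show ∀ n, n + 2 - 1 = n + 1 from fun n => rfl] at hxi ⊢
    push_cast at hxi ⊢
    linear_combination ((p : R) + 2) ^ 2 * x i ^ p * hxi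
  set ρ : Equiv.Perm (Fin N) := Equiv.subRight 1 with hρ
  have hρi : ∀ i, ρ i = i - 1 := fun i => rfl
  have term : ∀ σ : Equiv.Perm (Fin N), σ ≠ ρ →
      ∏ i, M (σ i) i = ((∏ i, loopCoeff a (σ i) i : ℤ) : R) * m := by
    intro σ hσρ
    by_cases hσ : ∀ i, σ i = i ∨ σ i = i + 1 ∨ σ i = i - 1
    · rcases eq_rotation_or_involutive h1 h2 σ hσ with h | h | h
      · simp only [h, Mup, Cup, Finset.prod_mul_distrib, hm]
        push_cast
        rfl
      · exact absurd (Equiv.ext h) hσρ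
      · rw [← hdm]
        push_cast
        rw [← Finset.prod_mul_distrib]
        refine prod_eq_prod_of_involutive σ h _ _ ?_ ?_
        · intro i hi
          rw [hi, Mdiag]
        · intro i _
          rw [h i]
          rcases hσ i with hi | hi | hi
          · rw [hi, Mdiag]
          · rw [hi, pair]
          · have := pair (i - 1)
            rw [sub_add_cancel] at this
            rw [hi, mul_comm, this, mul_comm]
    · push Not at hσ
      obtain ⟨i, hi0, hi1, hi2⟩ := hσ
      rw [Finset.prod_eq_zero (Finset.mem_univ i) (by simp [hM, hi0, hi1, hi2]),
        Finset.prod_eq_zero (Finset.mem_univ i) (by simp [loopCoeff, hi0, hi1, hi2])]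
      simp
  have termM : ∏ i, M (ρ i) i = ((∏ i, (a i : ℤ) : ℤ) : R) * m := by
    simp only [hρi, Mdown]
    have shift : ∏ i, (a (i - 1) : R) * x (i - 1) ^ (a (i - 1) - 1) =
        ∏ i, (a i : R) * x i ^ (a i - 1) :=
      Equiv.prod_comp ρ fun i => (a i : R) * x i ^ (a i - 1)
    rw [shift, Finset.prod_mul_distrib]
    push_cast
    rfl
  have termC : ∏ i, loopCoeff a (ρ i) i = (-1) ^ N * (∏ i, (a i : ℤ)) ^ 2 := by
    simp only [hρi, Cdown]
    have shift : ∏ i, (a (i - 1) : ℤ) = ∏ i, (a i : ℤ) :=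
      Equiv.prod_comp ρ fun i => (a i : ℤ)
    rw [Finset.prod_neg, Finset.prod_mul_distrib, shift]
    simp [sq]
  set A := ∏ i, (a i : ℤ) with hA
  have hA2 : 2 ≤ A := by
    have : (2 : ℤ) ^ N ≤ A := by
      have := Finset.prod_le_prod (s := Finset.univ) (f := fun _ : Fin N => (2 : ℤ))
        (g := fun i => (a i : ℤ)) (fun _ _ => by norm_num) (fun i _ => by exact_mod_cast ha i)
      simpa using this
    exact (le_self_pow₀ (by norm_num) (by omega)).trans this
  refine ⟨((Equiv.Perm.sign ρ : ℤˣ) : ℤ) * (A - (-1) ^ N * A ^ 2), ?_, ?_⟩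
  · refine mul_ne_zero (Units.ne_zero _) ?_
    rcases neg_one_pow_eq_or ℤ N with h | h <;> rw [h] <;> nlinarith
  · have hC := det_loopCoeff a
    rw [Matrix.det_apply', ← Finset.add_sum_erase _ _ (Finset.mem_univ ρ), termC] at hC
    simp only [Int.cast_id] at hC
    rw [Matrix.det_apply', ← Finset.add_sum_erase _ _ (Finset.mem_univ ρ), termM]
    have e : ∑ σ ∈ Finset.univ.erase ρ, ((Equiv.Perm.sign σ : ℤ) : R) * ∏ i, M (σ i) i =
        ((-(((Equiv.Perm.sign ρ : ℤˣ) : ℤ) * ((-1) ^ N * A ^ 2)) : ℤ) : R) * m := by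
      rw [← eq_neg_of_add_eq_zero_right hC, Int.cast_sum, Finset.sum_mul]
      refine Finset.sum_congr rfl fun σ hσ => ?_
      rw [term σ (Finset.ne_of_mem_erase hσ), Int.cast_mul, mul_assoc]
    rw [e]
    push_cast
    ring

lemma pderiv_loopW (N : ℕ) [NeZero N] (a : Fin N → ℕ) (i : Fin N) :
    pderiv i (loopW N a) =
      (a i : MvPolynomial (Fin N) ℂ) * X i ^ (a i - 1) * X (i + 1) + X (i - 1) ^ a (i - 1) := by
  have e : ∀ k, k + 1 = i ↔ k = i - 1 := fun k => eq_sub_iff_add_eq.symm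
  simp [loopW, pderiv_X, Pi.single_apply, Finset.sum_add_distrib, e]
  ring

lemma pderiv_pderiv_loopW (N : ℕ) [NeZero N] (a : Fin N → ℕ) (ha : ∀ i, 2 ≤ a i) (j i : Fin N) :
    pderiv j (pderiv i (loopW N a)) =
      (a i : MvPolynomial (Fin N) ℂ) * (((a i : MvPolynomial (Fin N) ℂ) - 1) * X i ^ (a i - 2) *
          X (i + 1) * (if j = i then 1 else 0)
        + X i ^ (a i - 1) * (if j = i + 1 then 1 else 0))
      + (a (i - 1) : MvPolynomial (Fin N) ℂ) * X (i - 1) ^ (a (i - 1) - 1) *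
          (if j = i - 1 then 1 else 0) := by
  rw [pderiv_loopW]
  have e : a i - 1 - 1 = a i - 2 := by omega
  have e' : ((a i - 1 : ℕ) : MvPolynomial (Fin N) ℂ) =
      (a i : MvPolynomial (Fin N) ℂ) - 1 := by
    rw [Nat.cast_sub (by have := ha i; omega)]; simp
  have e3 : ∀ k, (pderiv j (X k : MvPolynomial (Fin N) ℂ)) = if j = k then 1 else 0 := by
    intro k; rw [pderiv_X, Pi.single_apply]; simp only [eq_comm]
  simp only [map_add, Derivation.leibniz, Derivation.leibniz_pow, Derivation.map_natCast, e3, e,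
    smul_eq_mul, nsmul_eq_mul, e', mul_zero, add_zero]
  ring

/-- The two-variable analogue of `det_eq_of_jacobian_relations`, where both off-diagonal
contributions fall on the same entry. -/
lemma det_eq_of_jacobian_relations_two [NeZero 2] (a : Fin 2 → ℕ)
    (ha : ∀ i, 2 ≤ a i) {R : Type*} [CommRing R] (x : Fin 2 → R)
    (hx : ∀ i, a (i + 1) * x (i + 1) ^ (a (i + 1) - 1) * x (i + 1 + 1) + x i ^ a i = 0)
    (M : Matrix (Fin 2) (Fin 2) R)
    (hM : ∀ j i, M j i = a i * ((a i - 1) * x i ^ (a i - 2) * x (i + 1) * (if j = i then 1 else 0)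
        + x i ^ (a i - 1) * (if j = i + 1 then 1 else 0))
      + a (i - 1) * x (i - 1) ^ (a (i - 1) - 1) * (if j = i - 1 then 1 else 0)) :
    ∃ c : ℤ, c ≠ 0 ∧ M.det = c * ∏ i, x i ^ (a i - 1) := by
  have x0 := hx 0
  have x1 := hx 1
  have s : (1 + 1 : Fin 2) = 0 := rfl
  have t : (0 - 1 : Fin 2) = 1 := rfl
  simp only [zero_add, s] at x0 x1
  obtain ⟨p, hp⟩ : ∃ p, a 0 = p + 2 := ⟨a 0 - 2, by have := ha 0; omega⟩
  obtain ⟨q, hq⟩ : ∃ q, a 1 = q + 2 := ⟨a 1 - 2, by have := ha 1; omega⟩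
  rw [hp, hq] at x0 x1
  refine ⟨(p + 2) * (q + 2) * ((p + 2) * (q + 2) - 1), ?_, ?_⟩
  · have : (0 : ℤ) < (p + 2) * (q + 2) := by positivity
    have : (1 : ℤ) < (p + 2) * (q + 2) := by nlinarith
    exact mul_ne_zero (by omega) (by omega)
  · rw [Matrix.det_fin_two, Fin.prod_univ_two]
    simp only [hM, zero_add, s, t, sub_self, hp, hq, zero_ne_one, one_ne_zero, if_true, if_false,
      Nat.add_sub_cancel, show ∀ n, n + 2 - 1 = n + 1 from fun n => rfl] at x0 x1 ⊢
    push_cast at x0 x1 ⊢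
    linear_combination (-((p : R) + 2) ^ 2 * x 0 ^ p) * x0 - (((q : R) + 2) ^ 2 * x 1 ^ q) * x1

/-- In the Milnor ring of the loop polynomial, the Hessian determinant is a nonzero
scalar multiple of the monomial `∏ X i ^ (a i - 1)`. -/
theorem loop_hess (N : ℕ) [NeZero N] (hN : 2 ≤ N) (a : Fin N → ℕ)
    (ha : ∀ i, 2 ≤ a i) :
    ∃ c : ℂ, c ≠ 0 ∧
      Ideal.Quotient.mk (jacIdeal (loopW N a)) (hess (loopW N a)) =
        c • Ideal.Quotient.mk (jacIdeal (loopW N a)) (∏ i : Fin N, X i ^ (a i - 1)) := by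
  set π := Ideal.Quotient.mk (jacIdeal (loopW N a)) with hπ
  set x : Fin N → MilnorRing (loopW N a) := fun i => π (X i) with hx
  set M : Matrix (Fin N) (Fin N) (MilnorRing (loopW N a)) :=
    Matrix.of fun j i => π (pderiv j (pderiv i (loopW N a))) with hM
  have rel : ∀ i, a (i + 1) * x (i + 1) ^ (a (i + 1) - 1) * x (i + 1 + 1) + x i ^ a i = 0 := by
    intro i
    have h : π (pderiv (i + 1) (loopW N a)) = 0 :=
      Ideal.Quotient.eq_zero_iff_mem.mpr (Ideal.subset_span ⟨i + 1, rfl⟩)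
    rw [pderiv_loopW, add_sub_cancel_right] at h
    simpa using h
  have entry : ∀ j i, M j i =
      a i * ((a i - 1) * x i ^ (a i - 2) * x (i + 1) * (if j = i then 1 else 0)
        + x i ^ (a i - 1) * (if j = i + 1 then 1 else 0))
      + a (i - 1) * x (i - 1) ^ (a (i - 1) - 1) * (if j = i - 1 then 1 else 0) := by
    intro j i
    simp only [hM, Matrix.of_apply, pderiv_pderiv_loopW N a ha]
    simp [hx, apply_ite π]
  have det : π (hess (loopW N a)) = M.det := by
    rw [hess, RingHom.map_det]; rfl
  have main : ∃ c : ℤ, c ≠ 0 ∧ M.det = c * ∏ i, x i ^ (a i - 1) := by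
    rcases Nat.lt_or_ge 2 N with h | h
    · exact det_eq_of_jacobian_relations h a ha x rel M entry
    · obtain rfl : N = 2 := le_antisymm h hN
      exact det_eq_of_jacobian_relations_two a ha x rel M entry
  obtain ⟨c, hc, h⟩ := main
  refine ⟨c, by exact_mod_cast hc, ?_⟩
  have smul : (c : ℂ) • π (∏ i, X i ^ (a i - 1)) = π ((c : ℂ) • ∏ i, X i ^ (a i - 1)) := rfl
  rw [det, h, smul, MvPolynomial.smul_eq_C_mul, map_intCast, map_mul, map_intCast, map_prod]
  simp [hx]
end

section
/- Let W be the chain polynomial W = X_1^{a_1}X_2 + … + X_{N−1}^{a_{N−1}}X_N + X_N^{a_N}. There exists a nonzero complex number c such that, in the Milnor ring Q_W, the image of the Hessian determinant hess(W) equals c times the image of the monomial X_1^{a_1 − 2}·∏_{i=2}^N X_i^{a_i − 1}. -/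
open MvPolynomial

/-- The chain polynomial `W = X 1 ^ a 1 * X 2 + ⋯ + X (N-1) ^ a (N-1) * X N + X N ^ a N`. -/
noncomputable def chainW (N : ℕ) (a : Fin N → ℕ) : MvPolynomial (Fin N) ℂ :=
  ∑ i : Fin N, X i ^ a i * (if h : (i : ℕ) + 1 < N then X ⟨(i : ℕ) + 1, h⟩ else 1)

open Matrix in
/-- Laplace expansion of a determinant whose first row and column vanish beyond the second entry. -/
theorem det_eq_of_first_row_col_tridiagonal {R : Type*} [CommRing R] {n : ℕ}
    (A : Matrix (Fin (n + 2)) (Fin (n + 2)) R)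
    (hrow : ∀ j : Fin n, A 0 j.succ.succ = 0) (hcol : ∀ j : Fin n, A j.succ.succ 0 = 0) :
    A.det = A 0 0 * (A.submatrix Fin.succ Fin.succ).det -
      A 0 1 * A 1 0 * (A.submatrix (Fin.succ ∘ Fin.succ) (Fin.succ ∘ Fin.succ)).det := by
  have hminor : (A.submatrix Fin.succ (Fin.succAbove 1)).det =
      A 1 0 * (A.submatrix (Fin.succ ∘ Fin.succ) (Fin.succ ∘ Fin.succ)).det := by
    rw [det_succ_column_zero, Fin.sum_univ_succ, Finset.sum_eq_zero]
    · have hcomp : (Fin.succAbove (1 : Fin (n + 2))) ∘ Fin.succ = Fin.succ ∘ Fin.succ := by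
        funext j
        exact Fin.succ_succAbove_succ 0 j
      simp [submatrix_submatrix, hcomp, Function.comp_def]
    · intro j _
      simp [hcol]
  rw [det_succ_row_zero, Fin.sum_univ_succ, Fin.sum_univ_succ, Finset.sum_eq_zero]
  · simp [hminor]
    ring
  · intro j _
    simp [hrow]

/-- A tridiagonal determinant is a positive multiple of `∏ i, m i` if its diagonal entries are
positive multiples of the `m i` and the products of opposite off-diagonal entries are nonpositive
multiples of `m i * m (i + 1)`. -/
theorem exists_pos_det_tridiagonal_eq {R : Type*} [CommRing R] (n : ℕ)
    (A : Matrix (Fin n) (Fin n) R) (m : Fin n → R)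
    (hdiag : ∀ i, ∃ d : ℕ, 0 < d ∧ A i i = d * m i)
    (hoff : ∀ i j : Fin n, (i : ℕ) + 1 = j → ∃ e : ℕ, A i j * A j i = -(e * (m i * m j)))
    (hzero : ∀ i j : Fin n, (i : ℕ) + 1 < j → A i j = 0 ∧ A j i = 0) :
    ∃ c : ℕ, 0 < c ∧ A.det = c * ∏ i, m i := by
  induction n using Nat.strong_induction_on with
  | _ n ih =>
  match n, A, m, hdiag, hoff, hzero, ih with
  | 0, A, m, _, _, _, _ => exact ⟨1, one_pos, by simp⟩
  | 1, A, m, hdiag, _, _, _ =>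
    obtain ⟨d, hd, h⟩ := hdiag 0
    exact ⟨d, hd, by simp [h]⟩
  | n + 2, A, m, hdiag, hoff, hzero, ih =>
    obtain ⟨c₁, hc₁, h₁⟩ := ih (n + 1) (by omega) (A.submatrix Fin.succ Fin.succ)
      (fun i => m i.succ) (fun i => hdiag i.succ)
      (fun i j h => hoff i.succ j.succ (by simpa using h))
      (fun i j h => hzero i.succ j.succ (by simpa using h))
    obtain ⟨c₂, -, h₂⟩ := ih n (by omega)
      (A.submatrix (Fin.succ ∘ Fin.succ) (Fin.succ ∘ Fin.succ))
      (fun i => m i.succ.succ) (fun i => hdiag i.succ.succ)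
      (fun i j h => hoff i.succ.succ j.succ.succ (by simpa using h))
      (fun i j h => hzero i.succ.succ j.succ.succ (by simpa using h))
    obtain ⟨d, hd, h₀⟩ := hdiag 0
    obtain ⟨e, he⟩ := hoff 0 1 (by simp)
    refine ⟨d * c₁ + e * c₂, by positivity, ?_⟩
    rw [det_eq_of_first_row_col_tridiagonal A (fun j => (hzero 0 j.succ.succ (by simp)).1)
      (fun j => (hzero 0 j.succ.succ (by simp)).2), h₁, h₂, h₀, he]
    simp only [Fin.prod_univ_succ, Fin.succ_zero_eq_one]
    push_cast
    ring

/-- The variable following `X i`, or `1` if `i` is the last index. -/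
noncomputable def nextX {N : ℕ} (i : Fin N) : MvPolynomial (Fin N) ℂ :=
  if h : (i : ℕ) + 1 < N then X ⟨(i : ℕ) + 1, h⟩ else 1

theorem pderiv_nextX {N : ℕ} (i k : Fin N) :
    pderiv i (nextX k) = if (k : ℕ) + 1 = i then 1 else 0 := by
  unfold nextX
  split_ifs with h h' h'
  · have : (⟨(k : ℕ) + 1, h⟩ : Fin N) = i := Fin.ext h'
    rw [this, pderiv_X_self]
  · exact pderiv_X_of_ne fun h'' => h' (congrArg Fin.val h'')
  · exact absurd (h' ▸ i.isLt) h
  · exact pderiv_one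

theorem pderiv_X_pow {N : ℕ} (i k : Fin N) (r : ℕ) :
    pderiv i (X k ^ r : MvPolynomial (Fin N) ℂ) =
      if k = i then (r : MvPolynomial (Fin N) ℂ) * X k ^ (r - 1) else 0 := by
  rw [pderiv_pow]
  split_ifs with h
  · rw [h, pderiv_X_self, mul_one]
  · rw [pderiv_X_of_ne h, mul_zero]

theorem pderiv_chainW {N : ℕ} (a : Fin N → ℕ) (j : Fin N) :
    pderiv j (chainW N a) = (a j : MvPolynomial (Fin N) ℂ) * X j ^ (a j - 1) * nextX j +
      ∑ k : Fin N, if (k : ℕ) + 1 = j then X k ^ a k else 0 := by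
  change pderiv j (∑ k : Fin N, X k ^ a k * nextX k) = _
  simp only [map_sum, pderiv_mul, pderiv_nextX, pderiv_X_pow, Finset.sum_add_distrib, ite_mul,
    mul_ite, zero_mul, mul_zero, mul_one, Finset.sum_ite_eq', Finset.mem_univ, if_true]

theorem pderiv_pderiv_chainW {N : ℕ} (a : Fin N → ℕ) (i j : Fin N) :
    pderiv i (pderiv j (chainW N a)) =
      (if j = i then (a j * (a j - 1 : ℕ) : MvPolynomial (Fin N) ℂ) * (X j ^ (a j - 2) * nextX j)
        else 0) +
      (if (j : ℕ) + 1 = i then (a j : MvPolynomial (Fin N) ℂ) * X j ^ (a j - 1) else 0) +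
      (if (i : ℕ) + 1 = j then (a i : MvPolynomial (Fin N) ℂ) * X i ^ (a i - 1) else 0) := by
  have hsum : pderiv i (∑ k : Fin N, if (k : ℕ) + 1 = j then
      (X k ^ a k : MvPolynomial (Fin N) ℂ) else 0) =
      if (i : ℕ) + 1 = j then (a i : MvPolynomial (Fin N) ℂ) * X i ^ (a i - 1) else 0 := by
    rw [map_sum, Finset.sum_eq_single i]
    · split_ifs <;> simp
    · intro k _ hk
      split_ifs <;> simp [hk]
    · simp
  rw [pderiv_chainW, map_add, hsum]
  congr 1
  rw [pderiv_mul, pderiv_mul, pderiv_nextX, pderiv_X_pow, Derivation.map_natCast]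
  have : a j - 1 - 1 = a j - 2 := by omega
  split_ifs <;> simp [this] <;> ring

theorem X_pow_eq_of_chainW {N : ℕ} (a : Fin N → ℕ) {i j : Fin N} (hij : (i : ℕ) + 1 = j) :
    Ideal.Quotient.mk (jacIdeal (chainW N a)) (X i ^ a i) =
      Ideal.Quotient.mk (jacIdeal (chainW N a))
        (-((a j : MvPolynomial (Fin N) ℂ) * X j ^ (a j - 1) * nextX j)) := by
  rw [Ideal.Quotient.mk_eq_mk_iff_sub_mem, sub_neg_eq_add, add_comm]
  have hsum : (∑ k : Fin N, if (k : ℕ) + 1 = j then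
      (X k ^ a k : MvPolynomial (Fin N) ℂ) else 0) = X i ^ a i := by
    rw [Finset.sum_eq_single i]
    · simp [hij]
    · intro k _ hk
      exact if_neg fun h => hk (Fin.ext (by omega))
    · simp
  rw [← hsum, ← pderiv_chainW]
  exact Ideal.subset_span ⟨j, rfl⟩

theorem prod_X_pow_mul_nextX {N : ℕ} (a : Fin N → ℕ) (ha : ∀ i, 2 ≤ a i) :
    ∏ i : Fin N, (X i ^ (a i - 2) * nextX i) =
      ∏ i : Fin N, X i ^ (if (i : ℕ) = 0 then a i - 2 else a i - 1) := by
  cases N with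
  | zero => simp
  | succ n =>
    have hnext : ∏ i : Fin (n + 1), nextX i =
        ∏ i : Fin n, (X i.succ : MvPolynomial (Fin (n + 1)) ℂ) := by
      rw [Fin.prod_univ_castSucc]
      simp [nextX, Fin.succ]
    rw [Finset.prod_mul_distrib, hnext, Fin.prod_univ_succ, Fin.prod_univ_succ, mul_assoc,
      ← Finset.prod_mul_distrib]
    congr 1
    refine Finset.prod_congr rfl fun i _ => ?_
    rw [if_neg (by simp), ← pow_succ]
    congr 1
    have := ha i.succ
    omega

/-- In the Milnor ring of the chain polynomial, the Hessian determinant is a nonzero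
scalar multiple of the monomial `X 1 ^ (a 1 - 2) * ∏_{i ≥ 2} X i ^ (a i - 1)`
(here written with zero-based `Fin N` indices: the first variable is `X 0`). -/
theorem chain_hess (N : ℕ) (hN : 2 ≤ N) (a : Fin N → ℕ)
    (ha : ∀ i, 2 ≤ a i) :
    ∃ c : ℂ, c ≠ 0 ∧
      Ideal.Quotient.mk (jacIdeal (chainW N a)) (hess (chainW N a)) =
        c • Ideal.Quotient.mk (jacIdeal (chainW N a))
          (∏ i : Fin N, X i ^ (if (i : ℕ) = 0 then a i - 2 else a i - 1)) := by
  set π := Ideal.Quotient.mk (jacIdeal (chainW N a))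
  obtain ⟨c, hc, h⟩ : ∃ c : ℕ, 0 < c ∧
      (π.mapMatrix (Matrix.of fun i j => pderiv i (pderiv j (chainW N a)))).det =
        c * ∏ i, π (X i ^ (a i - 2) * nextX i) := by
    apply exists_pos_det_tridiagonal_eq
    · intro i
      have := ha i
      refine ⟨a i * (a i - 1), Nat.mul_pos (by omega) (by omega), ?_⟩
      simp [pderiv_pderiv_chainW]
    · intro i j hij
      refine ⟨a i ^ 2 * a j, ?_⟩
      have hji : j ≠ i := fun h => by simp [h] at hij
      have hji' : ¬ (j : ℕ) + 1 = i := by omega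
      have hpow : (X i ^ (a i - 1) * X i ^ (a i - 1) : MvPolynomial (Fin N) ℂ) =
          X i ^ (a i - 2) * X i ^ a i := by
        rw [← pow_add, ← pow_add]
        congr 1
        have := ha i
        omega
      have hX : (X j ^ (a j - 1) : MvPolynomial (Fin N) ℂ) = X j ^ (a j - 2) * X j := by
        rw [← pow_succ]
        congr 1
        have := ha j
        omega
      have hnext : (nextX i : MvPolynomial (Fin N) ℂ) = X j := by
        have hlt : (i : ℕ) + 1 < N := hij ▸ j.isLt
        rw [nextX, dif_pos hlt]
        exact congrArg X (Fin.ext hij)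
      have hentry : π.mapMatrix (Matrix.of fun i j => pderiv i (pderiv j (chainW N a))) i j *
          π.mapMatrix (Matrix.of fun i j => pderiv i (pderiv j (chainW N a))) j i =
          (a i : _) ^ 2 * (π (X i ^ (a i - 1) * X i ^ (a i - 1))) := by
        simp [pderiv_pderiv_chainW, hij, hji, hji.symm, hji']
        ring
      rw [hentry, hpow, map_mul, X_pow_eq_of_chainW a hij, hnext, hX]
      simp only [map_neg, map_mul, map_natCast, Nat.cast_mul, Nat.cast_pow]
      ring
    · intro i j hij
      have h₁ : i ≠ j := fun h => by simp [h] at hij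
      have h₂ : ¬ (i : ℕ) + 1 = j := by omega
      have h₃ : ¬ (j : ℕ) + 1 = i := by omega
      simp [pderiv_pderiv_chainW, h₁, h₁.symm, h₂, h₃]
  refine ⟨c, Nat.cast_ne_zero.mpr hc.ne', ?_⟩
  rw [hess, RingHom.map_det, h, ← map_prod, prod_X_pow_mul_nextX a ha, Nat.cast_smul_eq_nsmul,
    nsmul_eq_mul]
end

section
/- Let M be the exponent matrix of the loop polynomial with exponents a_1, …, a_N. Suppose v ∈ ℤ^N satisfies v = Mᵀ n for some integer vector n ∈ ℤ^N, and 2 ≤ v_i ≤ 2a_i for every i. Then one of the following holds: (a) v_i = a_i + 1 for every i; (b) v_i = δ_odd(i)·(2a_i − 2) + 2 for every i; (c) v_i = δ_even(i)·(2a_i − 2) + 2 for every i. Moreover, cases (b) and (c) can occur only if N is even. -/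
/-- The exponent matrix of the loop polynomial with exponents `a`:
`M i i = a i`, `M i (i+1) = 1` (indices mod `N`), all other entries `0`. -/
def loopMatrix (N : ℕ) [NeZero N] (a : Fin N → ℤ) : Matrix (Fin N) (Fin N) ℤ :=
  Matrix.of fun i j => if j = i then a i else if j = i + 1 then 1 else 0

/-- The `i`-th coordinate of `Mᵀ n` for the loop exponent matrix `M`. -/
lemma loopMatrix_transpose_mulVec (N : ℕ) [NeZero N] (hN : 2 ≤ N) (a n : Fin N → ℤ) (i : Fin N) :
    (loopMatrix N a).transpose.mulVec n i = a i * n i + n (i - 1) := by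
  have hne : i ≠ i - 1 := by
    intro h
    have h1 : (1 : Fin N) = 0 := sub_eq_self.1 h.symm
    have h2 := congrArg Fin.val h1
    rw [Fin.val_one', Fin.val_zero, Nat.mod_eq_of_lt hN] at h2
    exact one_ne_zero h2
  have key : ∀ j, (loopMatrix N a).transpose i j * n j =
      (if j = i then a i * n i else 0) + (if j = i - 1 then n (i - 1) else 0) := by
    intro j
    simp only [Matrix.transpose_apply, loopMatrix, Matrix.of_apply]
    by_cases h : j = i
    · subst h
      simp [hne]
    · by_cases h' : j = i - 1
      · subst h'
        simp [hne, hne.symm]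
      · have : i ≠ j + 1 := fun e => h' (eq_sub_of_add_eq e.symm)
        simp [h, h', this, Ne.symm h]
  simp only [Matrix.mulVec, dotProduct, key, Finset.sum_add_distrib, Finset.sum_ite_eq',
    Finset.mem_univ, if_true]

/-- If `|a i * m i + m (i - 1)| ≤ a i - 1` cyclically, then every `|m i|` is at most one. -/
lemma abs_le_one_of_cyclic_bound {N : ℕ} [NeZero N] {a m : Fin N → ℤ} (ha : ∀ i, 2 ≤ a i)
    (h : ∀ i, |a i * m i + m (i - 1)| ≤ a i - 1) (i : Fin N) : |m i| ≤ 1 := by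
  obtain ⟨j, hj⟩ := Finite.exists_max fun i => |m i|
  refine (hj i).trans ?_
  have h1 : a j * |m j| ≤ a j - 1 + |m j| := by
    calc a j * |m j| = |a j * m j| := by
          rw [abs_mul, abs_of_nonneg (show 0 ≤ a j by linarith [ha j])]
      _ = |(a j * m j + m (j - 1)) - m (j - 1)| := by ring_nf
      _ ≤ |a j * m j + m (j - 1)| + |m (j - 1)| := abs_sub _ _
      _ ≤ a j - 1 + |m j| := add_le_add (h j) (hj _)
  nlinarith [ha j]

/-- Under the same cyclic bound, a nonzero entry forces its predecessor to be its negative. -/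
lemma pred_eq_neg_of_cyclic_bound {N : ℕ} [NeZero N] {a m : Fin N → ℤ} (ha : ∀ i, 2 ≤ a i)
    (h : ∀ i, |a i * m i + m (i - 1)| ≤ a i - 1) {i : Fin N} (hi : m i ≠ 0) :
    m (i - 1) = -m i := by
  have h1 := abs_le.1 (abs_le_one_of_cyclic_bound ha h i)
  have h2 := abs_le.1 (abs_le_one_of_cyclic_bound ha h (i - 1))
  have h3 := abs_le.1 (h i)
  have h4 : m i = 1 ∨ m i = -1 := by omega
  rcases h4 with h4 | h4 <;> rw [h4] at h3 ⊢ <;> omega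

open Fin.CommRing in
/-- Walking `k` steps back around the cycle from a nonzero entry multiplies it by `(-1) ^ k`. -/
lemma sub_natCast_eq_of_cyclic_bound {N : ℕ} [NeZero N] {a m : Fin N → ℤ} (ha : ∀ i, 2 ≤ a i)
    (h : ∀ i, |a i * m i + m (i - 1)| ≤ a i - 1) {i : Fin N} (hi : m i ≠ 0) (k : ℕ) :
    m (i - (k : Fin N)) = (-1) ^ k * m i := by
  induction k with
  | zero => simp
  | succ k ih =>
    have hne : m (i - (k : Fin N)) ≠ 0 := by
      rw [ih]
      exact mul_ne_zero (pow_ne_zero _ (by norm_num)) hi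
    rw [Nat.cast_succ, ← sub_sub, pred_eq_neg_of_cyclic_bound ha h hne, ih]
    ring

/-- If `v = Mᵀ n` for an integer vector `n` and `2 ≤ v i ≤ 2 a i` for all `i`, then
either `v i = a i + 1` for all `i`, or (`N` is even and) `v i = δ_odd(i) (2 a i - 2) + 2`
for all `i`, or (`N` is even and) `v i = δ_even(i) (2 a i - 2) + 2` for all `i`.
(Indices here are zero-based, so the one-based index `i+1` is odd exactly when
`(i : ℕ)` is even.) -/
theorem loop_srAn (N : ℕ) [NeZero N] (hN : 2 ≤ N) (a : Fin N → ℤ)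
    (ha : ∀ i, 2 ≤ a i) (v n : Fin N → ℤ)
    (hv : v = (loopMatrix N a).transpose.mulVec n)
    (hb : ∀ i, 2 ≤ v i ∧ v i ≤ 2 * a i) :
    (∀ i, v i = a i + 1) ∨
    (Even N ∧ ∀ i : Fin N, v i = (if Even (i : ℕ) then 2 * a i - 2 else 0) + 2) ∨
    (Even N ∧ ∀ i : Fin N, v i = (if Even (i : ℕ) then 0 else 2 * a i - 2) + 2) := by
  have hvi : ∀ i, v i = a i * n i + n (i - 1) := fun i => by
    rw [hv, loopMatrix_transpose_mulVec N hN]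
  obtain ⟨m, hm⟩ : ∃ m : Fin N → ℤ, ∀ i, n i = m i + 1 := ⟨fun i => n i - 1, by simp⟩
  have hvm : ∀ i, v i = a i * m i + m (i - 1) + (a i + 1) := fun i => by
    rw [hvi, hm, hm]
    ring
  have hbd : ∀ i, |a i * m i + m (i - 1)| ≤ a i - 1 := fun i => by
    have h1 := hb i
    rw [hvm] at h1
    exact abs_le.2 ⟨by linarith, by linarith⟩
  by_cases h0 : ∀ i, m i = 0
  · exact Or.inl fun i => by rw [hvm, h0, h0]; ring
  right
  push Not at h0
  obtain ⟨j, hj⟩ := h0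
  have hback := fun {i} (hi : m i ≠ 0) => sub_natCast_eq_of_cyclic_bound ha hbd hi
  have hne : ∀ i, m i ≠ 0 := fun i => by
    have h1 := hback hj (j - i).val
    rw [Fin.cast_val_eq_self, sub_sub_cancel] at h1
    rw [h1]
    exact mul_ne_zero (pow_ne_zero _ (by norm_num)) hj
  have hev : Even N := by
    by_contra ho
    have h1 := hback hj N
    rw [Fin.natCast_self, sub_zero, (Nat.not_even_iff_odd.1 ho).neg_one_pow] at h1
    omega
  have hzero : ∀ i : Fin N, m 0 = (-1) ^ (i : ℕ) * m i := fun i => by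
    have h1 := hback (hne i) i.val
    rwa [Fin.cast_val_eq_self, sub_self] at h1
  have hval : ∀ i, v i = (a i - 1) * m i + (a i + 1) := fun i => by
    rw [hvm, pred_eq_neg_of_cyclic_bound ha hbd (hne i)]
    ring
  have hm0 : m 0 = 1 ∨ m 0 = -1 := by
    have h1 := abs_le.1 (abs_le_one_of_cyclic_bound ha hbd 0)
    have h2 := hne 0
    omega
  refine hm0.imp (fun h => ⟨hev, fun i => ?_⟩) (fun h => ⟨hev, fun i => ?_⟩) <;>
  · have h1 := hzero i
    rw [h] at h1
    rw [hval]
    split_ifs with hi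
    · rw [hi.neg_one_pow, one_mul] at h1
      rw [← h1]
      ring
    · rw [(Nat.not_even_iff_odd.1 hi).neg_one_pow] at h1
      rw [show m i = -(-1 * m i) by ring, ← h1]
      ring
end

section
/- Let M be the exponent matrix of the loop polynomial with exponents a_1, …, a_N. Suppose r, s ∈ ℤ^N satisfy 0 ≤ r_i ≤ a_i − 1 and 0 ≤ s_i ≤ a_i − 1 for all i, and the rational vector (Mᵀ)⁻¹(r + s + 2·𝟙) has all entries in ℤ (where 𝟙 = (1, …, 1)ᵀ). Then one of the following holds: (a) r_i + s_i = a_i − 1 for every i; (b) r_i = s_i = δ_odd(i)·(a_i − 1) for every i; (c) r_i = s_i = δ_even(i)·(a_i − 1) for every i. Moreover, cases (b) and (c) can occur only if N is even. -/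
/-- The exponent matrix (over `ℚ`) of the loop polynomial with exponents `a`:
`M i i = a i`, `M i (i+1) = 1` (indices mod `N`), all other entries `0`. -/
def loopMatrixQ (N : ℕ) [NeZero N] (a : Fin N → ℤ) : Matrix (Fin N) (Fin N) ℚ :=
  Matrix.of fun i j => if j = i then (a i : ℚ) else if j = i + 1 then 1 else 0

open scoped Fin.NatCast in
/-- A predicate on `Fin N` which is stable under the cyclic successor and holds somewhere holds
everywhere. -/
theorem forall_of_cyclic_succ {N : ℕ} [NeZero N] (p : Fin N → Prop)
    (hp : ∀ i, p i → p (i + 1)) (i : Fin N) (hi : p i) (j : Fin N) : p j := by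
  have key : ∀ k : ℕ, p (i + (k : Fin N)) := by
    intro k
    induction k with
    | zero => simpa using hi
    | succ k ih =>
      have h := hp _ ih
      rwa [add_assoc, ← Nat.cast_succ] at h
  have h := key (j - i).val
  rwa [Fin.cast_val_eq_self, add_sub_cancel] at h

open scoped Fin.NatCast in
/-- A nowhere vanishing integer sequence on `Fin N` which changes sign at every cyclic step
alternates, and `N` is even. -/
theorem alternating_of_cyclic_neg {N : ℕ} [NeZero N] (w : Fin N → ℤ) (h0 : w 0 ≠ 0)
    (hw : ∀ i, w (i + 1) = -w i) :
    Even N ∧ ∀ i : Fin N, w i = if Even (i : ℕ) then w 0 else -w 0 := by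
  have key : ∀ k : ℕ, w (k : Fin N) = if Even k then w 0 else -w 0 := by
    intro k
    induction k with
    | zero => simp
    | succ k ih =>
      rw [Nat.cast_succ, hw, ih]
      by_cases hk : Even k <;> simp [hk, Nat.even_add_one]
  constructor
  · by_contra hN
    have h := key N
    rw [Fin.natCast_self, if_neg hN] at h
    omega
  · intro i
    have h := key i
    rwa [Fin.cast_val_eq_self] at h

theorem loopMatrixQ_transpose_mulVec {N : ℕ} [NeZero N] (hN : 2 ≤ N) (a : Fin N → ℤ)
    (z : Fin N → ℚ) (j : Fin N) :
    ((loopMatrixQ N a).transpose.mulVec z) (j + 1) = a (j + 1) * z (j + 1) + z j := by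
  have hne : j ≠ j + 1 := fun h => by
    have := Fin.one_eq_zero_iff.1 (left_eq_add.1 h)
    omega
  simp only [Matrix.mulVec, dotProduct, Matrix.transpose_apply, loopMatrixQ, Matrix.of_apply]
  have hterm : ∀ i : Fin N,
      (if j + 1 = i then (a i : ℚ) else if j + 1 = i + 1 then 1 else 0) * z i =
        (if j + 1 = i then (a i : ℚ) * z i else 0) + (if j = i then z i else 0) := by
    intro i
    by_cases h1 : j + 1 = i
    · have h2 : j ≠ i := fun h => hne (h.trans h1.symm)
      simp [h1, h2]
    · simp [h1]
  rw [Finset.sum_congr rfl fun i _ => hterm i, Finset.sum_add_distrib]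
  simp

theorem isUnit_det_loopMatrixQ_transpose {N : ℕ} [NeZero N] (hN : 2 ≤ N) (a : Fin N → ℤ)
    (ha : ∀ i, 2 ≤ a i) : IsUnit (loopMatrixQ N a).transpose.det := by
  rw [isUnit_iff_ne_zero]
  intro hdet
  obtain ⟨v, hv, hv0⟩ := Matrix.exists_mulVec_eq_zero_iff.2 hdet
  obtain ⟨m, hm⟩ := Finite.exists_max fun i => |v i|
  have hmul := loopMatrixQ_transpose_mulVec hN a v (m - 1)
  rw [hv0, sub_add_cancel, Pi.zero_apply] at hmul
  have ham : (2 : ℚ) ≤ a m := by exact_mod_cast ha m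
  have h1 : |v (m - 1)| = a m * |v m| := by
    rw [show v (m - 1) = -(a m * v m) by linarith, abs_neg, abs_mul,
      abs_of_nonneg (by linarith : (0 : ℚ) ≤ a m)]
  have h2 := hm (m - 1)
  have h3 : |v m| ≤ 0 := by nlinarith [abs_nonneg (v m)]
  exact hv (funext fun i => abs_nonpos_iff.1 ((hm i).trans h3))

/-- A cyclic integer sequence satisfying `|a (i + 1) * w (i + 1) + w i| ≤ a (i + 1) - 1` takes
values in `{-1, 0, 1}`. -/
theorem abs_le_one_of_cyclic {N : ℕ} [NeZero N] (a w : Fin N → ℤ) (ha : ∀ i, 2 ≤ a i)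
    (hw : ∀ i, |a (i + 1) * w (i + 1) + w i| ≤ a (i + 1) - 1) (i : Fin N) : |w i| ≤ 1 := by
  obtain ⟨m, hm⟩ := Finite.exists_max fun i => |w i|
  refine (hm i).trans ?_
  have h := hw (m - 1)
  rw [sub_add_cancel] at h
  have h1 : a m * |w m| ≤ |a m * w m + w (m - 1)| + |w (m - 1)| := by
    calc a m * |w m| = |a m * w m + w (m - 1) - w (m - 1)| := by
          rw [add_sub_cancel_right, abs_mul, abs_of_nonneg (by linarith [ha m] : 0 ≤ a m)]
      _ ≤ _ := abs_sub _ _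
  have h2 := hm (m - 1)
  have h3 := ha m
  nlinarith

/-- If `0 ≤ r i, s i ≤ a i - 1` for all `i` and `(Mᵀ)⁻¹ (r + s + 2·𝟙)` is an integer
vector, then either `r i + s i = a i - 1` for all `i`, or (`N` is even and)
`r i = s i = δ_odd(i) (a i - 1)` for all `i`, or (`N` is even and)
`r i = s i = δ_even(i) (a i - 1)` for all `i`.  (Indices here are zero-based, so the
one-based index `i+1` is odd exactly when `(i : ℕ)` is even.) -/
theorem loop_1of3 (N : ℕ) [NeZero N] (hN : 2 ≤ N) (a : Fin N → ℤ)
    (ha : ∀ i, 2 ≤ a i) (r s : Fin N → ℤ)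
    (hr : ∀ i, 0 ≤ r i ∧ r i ≤ a i - 1) (hs : ∀ i, 0 ≤ s i ∧ s i ≤ a i - 1)
    (hint : ∀ i : Fin N, ∃ z : ℤ,
      ((loopMatrixQ N a).transpose⁻¹.mulVec (fun j => (r j : ℚ) + s j + 2)) i = z) :
    (∀ i, r i + s i = a i - 1) ∨
    (Even N ∧ ∀ i : Fin N,
      r i = (if Even (i : ℕ) then a i - 1 else 0) ∧
      s i = (if Even (i : ℕ) then a i - 1 else 0)) ∨
    (Even N ∧ ∀ i : Fin N,
      r i = (if Even (i : ℕ) then 0 else a i - 1) ∧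
      s i = (if Even (i : ℕ) then 0 else a i - 1)) := by
  choose z hz using hint
  have hsol : ∀ j, a (j + 1) * z (j + 1) + z j = r (j + 1) + s (j + 1) + 2 := by
    intro j
    have h := loopMatrixQ_transpose_mulVec hN a (fun i => (z i : ℚ)) j
    rw [← funext hz, Matrix.mulVec_mulVec,
      Matrix.mul_nonsing_inv _ (isUnit_det_loopMatrixQ_transpose hN a ha),
      Matrix.one_mulVec] at h
    exact_mod_cast h.symm
  obtain ⟨w, hwz⟩ : ∃ w : Fin N → ℤ, ∀ i, z i = w i + 1 := ⟨fun i => z i - 1, by simp⟩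
  have hstep : ∀ j, a (j + 1) * w (j + 1) + w j = r (j + 1) + s (j + 1) + 1 - a (j + 1) := by
    intro j
    have h := hsol j
    rw [hwz, hwz] at h
    linarith
  have hcases : ∀ i, w i = -1 ∨ w i = 0 ∨ w i = 1 := by
    intro i
    have := abs_le.1 <| abs_le_one_of_cyclic a w ha (fun i => by
      rw [hstep, abs_le]
      have := hr (i + 1)
      have := hs (i + 1)
      omega) i
    omega
  have hpos : ∀ j, w (j + 1) = 1 →
      w j = -1 ∧ r (j + 1) = a (j + 1) - 1 ∧ s (j + 1) = a (j + 1) - 1 := by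
    intro j hj
    have h := hstep j
    rw [hj] at h
    have := hr (j + 1)
    have := hs (j + 1)
    have := hcases j
    omega
  have hneg : ∀ j, w (j + 1) = -1 → w j = 1 ∧ r (j + 1) = 0 ∧ s (j + 1) = 0 := by
    intro j hj
    have h := hstep j
    rw [hj] at h
    have := hr (j + 1)
    have := hs (j + 1)
    have := hcases j
    omega
  by_cases hzero : ∃ i, w i = 0
  · left
    obtain ⟨i, hi⟩ := hzero
    have hall := forall_of_cyclic_succ (fun i => w i = 0) (fun j hj => by
      have := hpos j
      have := hneg j
      have := hcases (j + 1)
      omega) i hi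
    intro j
    have h := hstep (j - 1)
    rw [sub_add_cancel, hall, hall] at h
    linarith
  · right
    push Not at hzero
    obtain ⟨hev, halt⟩ := alternating_of_cyclic_neg w (hzero 0) fun j => by
      have := hpos j
      have := hneg j
      have := hcases (j + 1)
      have := hzero (j + 1)
      omega
    have hpos' : ∀ j, w j = 1 → r j = a j - 1 ∧ s j = a j - 1 := fun j hj => by
      have h := hpos (j - 1)
      rw [sub_add_cancel] at h
      exact (h hj).2
    have hneg' : ∀ j, w j = -1 → r j = 0 ∧ s j = 0 := fun j hj => by
      have h := hneg (j - 1)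
      rw [sub_add_cancel] at h
      exact (h hj).2
    rcases hcases 0 with h0 | h0 | h0
    · refine Or.inr ⟨hev, fun i => ?_⟩
      have h := halt i
      split_ifs at h ⊢
      · exact hneg' i (by omega)
      · exact hpos' i (by omega)
    · exact absurd h0 (hzero 0)
    · refine Or.inl ⟨hev, fun i => ?_⟩
      have h := halt i
      split_ifs at h ⊢
      · exact hpos' i (by omega)
      · exact hneg' i (by omega)
end

section
/- Let M be the exponent matrix of the loop polynomial with exponents a_1, …, a_N. For every vector g ∈ ℚ^N such that Mg has all entries in ℤ but g does not have all entries in ℤ, there exists an integer vector r ∈ ℤ^N with 0 ≤ r_i ≤ a_i − 1 for all i such that g − M⁻¹(r + 𝟙) has all entries in ℤ (where 𝟙 = (1, …, 1)ᵀ). -/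
theorem loopMatrixQ_mulVec {N : ℕ} [NeZero N] (hN : 2 ≤ N) (a : Fin N → ℤ) (g : Fin N → ℚ)
    (i : Fin N) : (loopMatrixQ N a).mulVec g i = a i * g i + g (i + 1) := by
  have hne : i ≠ i + 1 := by
    simp [show N ≠ 1 by omega]
  have hterm : ∀ j, loopMatrixQ N a i j * g j =
      (if j = i then a i * g i else 0) + (if j = i + 1 then g (i + 1) else 0) := by
    intro j
    by_cases h₁ : j = i
    · subst h₁
      simp [loopMatrixQ, hne]
    · by_cases h₂ : j = i + 1
      · subst h₂
        simp [loopMatrixQ, hne.symm]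
      · simp [loopMatrixQ, h₁, h₂]
  simp only [Matrix.mulVec, dotProduct, hterm, Finset.sum_add_distrib, Finset.sum_ite_eq',
    Finset.mem_univ, if_true]

theorem loopMatrixQ_det_ne_zero {N : ℕ} [NeZero N] (a : Fin N → ℤ) (ha : ∀ i, 2 ≤ a i) :
    (loopMatrixQ N a).det ≠ 0 := by
  refine det_ne_zero_of_sum_row_lt_diag ?_
  intro k
  have hdiag : ‖loopMatrixQ N a k k‖ = |(a k : ℝ)| := by
    simp [loopMatrixQ, Int.norm_eq_abs]
  have hk' : (2 : ℝ) ≤ |(a k : ℝ)| := le_trans (by exact_mod_cast ha k) (le_abs_self _)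
  have hsum : ∑ j ∈ Finset.univ.erase k, ‖loopMatrixQ N a k j‖ ≤ 1 := by
    calc ∑ j ∈ Finset.univ.erase k, ‖loopMatrixQ N a k j‖
        ≤ ∑ j ∈ Finset.univ.erase k, (if j = k + 1 then (1 : ℝ) else 0) := by
          refine Finset.sum_le_sum fun j hj => ?_
          have hj' : j ≠ k := Finset.ne_of_mem_erase hj
          by_cases h : j = k + 1 <;> simp_all [loopMatrixQ]
      _ ≤ 1 := by
          rw [Finset.sum_ite_eq']
          split_ifs <;> norm_num
  rw [hdiag]
  linarith

/-- A property of the indices of a cycle that passes from each index to its successor holds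
everywhere as soon as it holds somewhere. -/
theorem Fin.forall_of_cyclic_step {N : ℕ} [NeZero N] {P : Fin N → Prop}
    (hstep : ∀ i, P i → P (i + 1)) {i : Fin N} (hi : P i) (j : Fin N) : P j := by
  have h : ∀ n : ℕ, P (i + Fin.ofNat N n) := by
    intro n
    induction n with
    | zero => simpa using hi
    | succ n ih =>
      have := hstep _ ih
      have e : i + Fin.ofNat N n + 1 = i + Fin.ofNat N (n + 1) := by
        simp [Fin.ext_iff, Fin.val_add, add_assoc]
      rwa [e] at this
  have e : i + Fin.ofNat N (N - i.val + j.val) = j := by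
    have := i.isLt
    simp only [Fin.ext_iff, Fin.val_add, Fin.val_ofNat, Nat.add_mod_mod]
    rw [show i.val + (N - i.val + j.val) = j.val + N by omega, Nat.add_mod_right,
      Nat.mod_eq_of_lt j.isLt]
  exact e ▸ h _

/-- Every nontrivial diagonal symmetry of the loop polynomial (a class of `g ∈ ℚ^N`
with `M g ∈ ℤ^N` but `g ∉ ℤ^N`) can be written, modulo `ℤ^N`, in the form
`M⁻¹ (r + 𝟙)` with `0 ≤ r i ≤ a i - 1`. -/
theorem loop_symmetry_representation (N : ℕ) [NeZero N] (hN : 2 ≤ N) (a : Fin N → ℤ)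
    (ha : ∀ i, 2 ≤ a i) (g : Fin N → ℚ)
    (hMg : ∀ i : Fin N, ∃ z : ℤ, ((loopMatrixQ N a).mulVec g) i = z)
    (hg : ¬ ∀ i : Fin N, ∃ z : ℤ, g i = z) :
    ∃ r : Fin N → ℤ, (∀ i, 0 ≤ r i ∧ r i ≤ a i - 1) ∧
      ∀ i : Fin N, ∃ z : ℤ,
        g i - ((loopMatrixQ N a)⁻¹.mulVec (fun j => (r j : ℚ) + 1)) i = z := by
  simp only [loopMatrixQ_mulVec hN] at hMg
  have hnonint : ∀ i, ¬ ∃ z : ℤ, g i = z := by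
    intro i hi
    refine hg (Fin.forall_of_cyclic_step (P := fun i => ∃ z : ℤ, g i = z) ?_ hi)
    rintro k ⟨z, hz⟩
    obtain ⟨w, hw⟩ := hMg k
    refine ⟨w - a k * z, ?_⟩
    push_cast
    rw [← hw, hz]
    ring
  have hpos : ∀ i, 0 < Int.fract (g i) := fun i =>
    (Int.fract_nonneg _).lt_of_ne' fun h =>
      hnonint i ⟨⌊g i⌋, by linarith [Int.floor_add_fract (g i)]⟩
  have hlt : ∀ i, Int.fract (g i) < 1 := fun i => Int.fract_lt_one _
  choose w hw using hMg
  let s : Fin N → ℤ := fun i => w i - a i * ⌊g i⌋ - ⌊g (i + 1)⌋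
  have hs : ∀ i, (s i : ℚ) = a i * Int.fract (g i) + Int.fract (g (i + 1)) := by
    intro i
    simp only [s, Int.fract]
    push_cast
    rw [← hw]
    ring
  refine ⟨fun i => s i - 1, fun i => ?_, fun i => ⟨⌊g i⌋, ?_⟩⟩
  · have hai : (2 : ℚ) ≤ a i := by exact_mod_cast ha i
    have h₁ : (0 : ℚ) < s i := by
      rw [hs]
      have := hpos i
      have := hpos (i + 1)
      positivity
    have h₂ : (s i : ℚ) < a i + 1 := by
      rw [hs]
      nlinarith [hlt i, hlt (i + 1)]
    have h₁' : 0 < s i := by exact_mod_cast h₁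
    have h₂' : s i < a i + 1 := by exact_mod_cast h₂
    dsimp only
    omega
  · have hvec : (fun j => ((s j - 1 : ℤ) : ℚ) + 1) =
        (loopMatrixQ N a).mulVec (fun j => Int.fract (g j)) := by
      funext j
      rw [loopMatrixQ_mulVec hN, ← hs]
      push_cast
      ring
    rw [hvec, Matrix.mulVec_mulVec,
      Matrix.nonsing_inv_mul _ (loopMatrixQ_det_ne_zero a ha).isUnit, Matrix.one_mulVec]
    exact Int.self_sub_fract _
end

section
/- Let M be the exponent matrix of the chain polynomial with exponents a_1, …, a_N. Define r ∈ ℤ^N by r_i = a_i − 1 if N − i is even and r_i = 0 if N − i is odd. Then M⁻¹(r + 𝟙) has all entries in ℤ (where 𝟙 = (1, …, 1)ᵀ). -/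
/-- The exponent matrix (over `ℚ`) of the chain polynomial with exponents `a`:
`M i i = a i`, `M i (i+1) = 1` for `i ≤ N - 1`, all other entries `0`. -/
def chainMatrixQ (N : ℕ) (a : Fin N → ℤ) : Matrix (Fin N) (Fin N) ℚ :=
  Matrix.of fun i j => if j = i then (a i : ℚ) else if (j : ℕ) = (i : ℕ) + 1 then 1 else 0

theorem det_chainMatrixQ (N : ℕ) (a : Fin N → ℤ) :
    (chainMatrixQ N a).det = ∏ i, (a i : ℚ) := by
  rw [Matrix.det_of_isUpperTriangular]
  · simp [chainMatrixQ]
  · intro i j hij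
    have hlt : (j : ℕ) < i := hij
    have hne : j ≠ i := fun h => by simp [h] at hlt
    simp only [chainMatrixQ, Matrix.of_apply, if_neg hne]
    rw [if_neg (by omega)]

theorem chainMatrixQ_mulVec_apply (N : ℕ) (a : Fin N → ℤ) (v : Fin N → ℚ) (i : Fin N) :
    (chainMatrixQ N a).mulVec v i =
      a i * v i + if h : (i : ℕ) + 1 < N then v ⟨i + 1, h⟩ else 0 := by
  have split_entry : ∀ j : Fin N, chainMatrixQ N a i j * v j =
      (if j = i then a i * v j else 0) + if (j : ℕ) = i + 1 then v j else 0 := by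
    intro j
    by_cases h : j = i <;> simp [chainMatrixQ, h]
  simp only [Matrix.mulVec, dotProduct, split_entry, Finset.sum_add_distrib,
    Finset.sum_ite_eq', Finset.mem_univ, if_true]
  congr 1
  split_ifs with h
  · rw [Finset.sum_eq_single ⟨i + 1, h⟩]
    · simp
    · intro j _ hj
      exact if_neg fun hji => hj (Fin.ext hji)
    · simp
  · refine Finset.sum_eq_zero fun j _ => if_neg ?_
    omega

theorem chainMatrixQ_mulVec_parity (N : ℕ) (a : Fin N → ℤ) :
    (chainMatrixQ N a).mulVec (fun j : Fin N => if Even (N - ((j : ℕ) + 1)) then 1 else 0) =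
      fun j : Fin N => (if Even (N - ((j : ℕ) + 1)) then (a j : ℚ) - 1 else 0) + 1 := by
  ext i
  rw [chainMatrixQ_mulVec_apply]
  have hi := i.isLt
  by_cases hlt : (i : ℕ) + 1 < N
  · have hpar : Even (N - ((i : ℕ) + 1 + 1)) ↔ ¬ Even (N - ((i : ℕ) + 1)) := by
      rw [Nat.even_iff, Nat.even_iff]
      omega
    by_cases he : Even (N - ((i : ℕ) + 1)) <;> simp [hlt, hpar, he]
  · have hz : N - ((i : ℕ) + 1) = 0 := by omega
    simp [hlt, hz]

/-- For the chain polynomial, `M⁻¹ (r + 𝟙)` is an integer vector, where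
`r i = a i - 1` when `N - i` is even (for the one-based index `i`, i.e.
`N - ((i : ℕ) + 1)` even for the zero-based `Fin N` index) and `r i = 0`
otherwise. -/
theorem chain_identity_representation (N : ℕ) (hN : 1 ≤ N) (a : Fin N → ℤ)
    (ha : ∀ i, 2 ≤ a i) :
    ∀ i : Fin N, ∃ z : ℤ,
      ((chainMatrixQ N a)⁻¹.mulVec
        (fun j => (if Even (N - ((j : ℕ) + 1)) then (a j : ℚ) - 1 else 0) + 1)) i = z := by
  have hdet : IsUnit (chainMatrixQ N a).det := by
    rw [det_chainMatrixQ, isUnit_iff_ne_zero, Finset.prod_ne_zero_iff]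
    intro i _
    have := ha i
    exact_mod_cast (by omega : a i ≠ 0)
  intro i
  rw [← chainMatrixQ_mulVec_parity, Matrix.mulVec_mulVec, Matrix.nonsing_inv_mul _ hdet,
    Matrix.one_mulVec]
  exact ⟨if Even (N - ((i : ℕ) + 1)) then 1 else 0, by push_cast; rfl⟩
end

section
/- Let M be an N×N integer matrix with nonzero determinant, and let L be an additive subgroup of ℚ^N with ℤ^N ⊆ L such that Mb has all entries in ℤ for every b ∈ L. Define the dual D_M(L) = {g ∈ ℚ^N : gᵀMb ∈ ℤ for all b ∈ L}, and similarly D_{Mᵀ}(K) = {b ∈ ℚ^N : bᵀMᵀg ∈ ℤ for all g ∈ K} for an additive subgroup K ⊆ ℚ^N. Then D_{Mᵀ}(D_M(L)) = L. -/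
open Matrix

/-- The Berglund–Hübsch–Krawitz dual of a lattice `L` of diagonal symmetries, with
respect to the (rational) exponent matrix `M`:
`D_M(L) = {g ∈ ℚ^N : gᵀ M b ∈ ℤ for all b ∈ L}`. -/
def bhkDual {N : ℕ} (M : Matrix (Fin N) (Fin N) ℚ) (L : Set (Fin N → ℚ)) :
    Set (Fin N → ℚ) :=
  {g : Fin N → ℚ | ∀ b ∈ L, ∃ z : ℤ, g ⬝ᵥ M.mulVec b = (z : ℚ)}

/-- An integer vector outside a subgroup `H` of `ℤ^ι` is separated from `H` by a rational
functional taking integral values on `H`. -/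
lemma exists_rat_dotProduct_separating {ι : Type*} [Fintype ι]
    (H : AddSubgroup (ι → ℤ)) {m : ι → ℤ} (hm : m ∉ H) :
    ∃ g : ι → ℚ, (∀ h ∈ H, ∃ z : ℤ, g ⬝ᵥ (fun i => (h i : ℚ)) = z) ∧
      ¬ ∃ z : ℤ, g ⬝ᵥ (fun i => (m i : ℚ)) = z := by
  classical
  have hne : (QuotientAddGroup.mk m : (ι → ℤ) ⧸ H) ≠ 0 :=
    fun h => hm ((QuotientAddGroup.eq_zero_iff m).1 h)
  obtain ⟨χ, hχ⟩ := CharacterModule.exists_character_apply_ne_zero_of_ne_zero hne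
  let ψ : (ι → ℤ) →+ AddCircle (1 : ℚ) :=
    AddMonoidHom.comp (χ : ((ι → ℤ) ⧸ H) →+ AddCircle (1 : ℚ)) (QuotientAddGroup.mk' H)
  choose g hg using fun i : ι => QuotientAddGroup.mk_surjective (ψ (Pi.single i 1))
  have hψ (v : ι → ℤ) : ((g ⬝ᵥ (fun i => (v i : ℚ)) : ℚ) : AddCircle (1 : ℚ)) = ψ v := by
    have hv : v = ∑ i, v i • Pi.single i (1 : ℤ) := by
      simpa using pi_eq_sum_univ' v
    conv_rhs => rw [hv, map_sum]
    simp only [map_zsmul, ← hg, dotProduct]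
    change QuotientAddGroup.mk' _ (∑ i, g i * (v i : ℚ)) = _
    rw [map_sum]
    refine Finset.sum_congr rfl fun i _ => ?_
    rw [mul_comm, ← zsmul_eq_mul, map_zsmul]
    rfl
  have hint (v : ι → ℤ) : (∃ z : ℤ, g ⬝ᵥ (fun i => (v i : ℚ)) = z) ↔ ψ v = 0 := by
    rw [← hψ, AddCircle.coe_eq_zero_iff]
    simp [eq_comm]
  refine ⟨g, fun h hh => (hint h).2 ?_, fun h => hχ ((hint m).1 h)⟩
  have h0 : (QuotientAddGroup.mk' H) h = 0 := (QuotientAddGroup.eq_zero_iff h).2 hh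
  exact (congrArg χ h0).trans (map_zero χ)

/-- Duality of the Berglund–Hübsch–Krawitz dual group construction: if `M` is an
integer matrix with nonzero determinant and `L` is an additive subgroup of `ℚ^N`
with `ℤ^N ⊆ L` and `M L ⊆ ℤ^N`, then `D_{Mᵀ}(D_M(L)) = L`. -/
theorem bhk_dual_dual (N : ℕ) (hN : 1 ≤ N) (M : Matrix (Fin N) (Fin N) ℤ)
    (hdet : M.det ≠ 0) (L : AddSubgroup (Fin N → ℚ))
    (hZL : ∀ z : Fin N → ℤ, (fun i => (z i : ℚ)) ∈ L)
    (hML : ∀ b ∈ L, ∀ i : Fin N, ∃ z : ℤ,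
      ((M.map (Int.cast : ℤ → ℚ)).mulVec b) i = (z : ℚ)) :
    bhkDual (M.map (Int.cast : ℤ → ℚ)).transpose
        (bhkDual (M.map (Int.cast : ℤ → ℚ)) (L : Set (Fin N → ℚ))) =
      (L : Set (Fin N → ℚ)) := by
  set A : Matrix (Fin N) (Fin N) ℚ := M.map (Int.cast : ℤ → ℚ)
  have hAdet : IsUnit A.det := by
    have : A.det = (M.det : ℚ) := ((Int.castRingHom ℚ).map_det M).symm
    rw [this, isUnit_iff_ne_zero]
    exact_mod_cast hdet
  have hswap (x g : Fin N → ℚ) : x ⬝ᵥ Aᵀ.mulVec g = g ⬝ᵥ A.mulVec x := by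
    rw [mulVec_transpose, dotProduct_comm, ← dotProduct_mulVec]
  apply Set.Subset.antisymm
  · intro x hx
    have hAx (i : Fin N) : ∃ z : ℤ, A.mulVec x i = z := by
      obtain ⟨z, hz⟩ := hx (Pi.single i 1) fun b hb => by
        simpa using hML b hb i
      exact ⟨z, by rwa [hswap, single_one_dotProduct] at hz⟩
    choose m hm using hAx
    let castHom : (Fin N → ℤ) →+ (Fin N → ℚ) := (Int.castAddHom ℚ).compLeft (Fin N)
    let H : AddSubgroup (Fin N → ℤ) :=
      L.comap ((A⁻¹.mulVecLin.toAddMonoidHom).comp castHom)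
    have hmem {b : Fin N → ℚ} {n : Fin N → ℤ} (hn : ∀ i, A.mulVec b i = n i) :
        n ∈ H ↔ b ∈ L := by
      have hb : castHom n = A.mulVec b := funext fun i => (hn i).symm
      change A⁻¹.mulVec (castHom n) ∈ L ↔ b ∈ L
      rw [hb, mulVec_mulVec, nonsing_inv_mul _ hAdet, one_mulVec]
    by_contra hxL
    obtain ⟨g, hgH, hgm⟩ := exists_rat_dotProduct_separating H (mt (hmem hm).1 hxL)
    refine hgm ?_
    rw [← funext hm, ← hswap]
    refine hx g fun b hb => ?_
    choose n hn using hML b hb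
    rw [funext hn]
    exact hgH n ((hmem hn).2 hb)
  · intro b hb g hg
    rw [hswap]
    exact hg b hb
end

section
/- Let M be an N×N integer matrix with nonzero determinant, and let L be an additive subgroup of ℚ^N with ℤ^N ⊆ L such that Mb has all entries in ℤ for every b ∈ L. Define the dual D_M(L) = {g ∈ ℚ^N : gᵀMb ∈ ℤ for all b ∈ L}. Then the vector J = M⁻¹𝟙 (where 𝟙 = (1, …, 1)ᵀ) lies in L if and only if every g ∈ D_M(L) satisfies Σ_{i=1}^N g_i ∈ ℤ. -/
open Matrix

/-- A subgroup of `ℤ^ι` is cut out by the rational covectors that are integral on it. -/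
theorem exists_rat_covector_separating {ι : Type*} [Fintype ι] [DecidableEq ι]
    (K : AddSubgroup (ι → ℤ)) {y : ι → ℤ} (hy : y ∉ K) :
    ∃ g : ι → ℚ, (∀ x ∈ K, ∃ z : ℤ, g ⬝ᵥ (fun i => (x i : ℚ)) = z) ∧
      ¬ ∃ z : ℤ, g ⬝ᵥ (fun i => (y i : ℚ)) = z := by
  obtain ⟨φ, hφ⟩ := CharacterModule.exists_character_apply_ne_zero_of_ne_zero
    (a := (QuotientAddGroup.mk y : (ι → ℤ) ⧸ K))
    (fun h => hy ((QuotientAddGroup.eq_zero_iff y).1 h))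
  let ψ : (ι → ℤ) →+ AddCircle (1 : ℚ) := AddMonoidHom.comp φ (QuotientAddGroup.mk' K)
  choose g hg using fun i => QuotientAddGroup.mk_surjective (ψ (Pi.single i 1))
  have hψ (x : ι → ℤ) : ((g ⬝ᵥ (fun i => (x i : ℚ)) : ℚ) : AddCircle (1 : ℚ)) = ψ x := by
    have hx : x = ∑ i, x i • (Pi.single i 1 : ι → ℤ) := pi_eq_sum_univ' x
    conv_rhs => rw [hx]
    rw [map_sum, dotProduct]
    refine (map_sum (QuotientAddGroup.mk' (AddSubgroup.zmultiples (1 : ℚ))) _ _).trans ?_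
    refine Finset.sum_congr rfl fun i _ => ?_
    rw [map_zsmul, ← hg, mul_comm, ← zsmul_eq_mul]
    exact map_zsmul (QuotientAddGroup.mk' (AddSubgroup.zmultiples (1 : ℚ))) _ _
  have integral_iff (x : ι → ℤ) :
      (∃ z : ℤ, g ⬝ᵥ (fun i => (x i : ℚ)) = z) ↔ ψ x = 0 := by
    rw [← hψ, AddCircle.coe_eq_zero_iff]
    simp [eq_comm]
  refine ⟨g, fun x hx => (integral_iff x).2 ?_, fun h => hφ ((integral_iff y).1 h)⟩
  change φ (QuotientAddGroup.mk x) = 0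
  rw [(QuotientAddGroup.eq_zero_iff x).2 hx, map_zero]

/-- If `M` is an integer matrix with nonzero determinant and `L` is an additive
subgroup of `ℚ^N` with `ℤ^N ⊆ L` and `M L ⊆ ℤ^N`, then the exponential grading
element `J = M⁻¹ 𝟙` lies in `L` if and only if every `g` in the dual `D_M(L)`
satisfies `∑ i, g i ∈ ℤ` (i.e. the dual group lies in `SL_N`). -/
theorem bhk_J_iff_SL (N : ℕ) (hN : 1 ≤ N) (M : Matrix (Fin N) (Fin N) ℤ)
    (hdet : M.det ≠ 0) (L : AddSubgroup (Fin N → ℚ))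
    (hZL : ∀ z : Fin N → ℤ, (fun i => (z i : ℚ)) ∈ L)
    (hML : ∀ b ∈ L, ∀ i : Fin N, ∃ z : ℤ,
      ((M.map (Int.cast : ℤ → ℚ)).mulVec b) i = (z : ℚ)) :
    (M.map (Int.cast : ℤ → ℚ))⁻¹.mulVec (fun _ => 1) ∈ L ↔
      ∀ g ∈ bhkDual (M.map (Int.cast : ℤ → ℚ)) (L : Set (Fin N → ℚ)),
        ∃ z : ℤ, (∑ i : Fin N, g i) = (z : ℚ) := by
  set A := M.map (Int.cast : ℤ → ℚ)
  have hA : IsUnit A.det := by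
    have h : A.det = (M.det : ℚ) := ((Int.castRingHom ℚ).map_det M).symm
    rw [h, isUnit_iff_ne_zero]
    exact_mod_cast hdet
  constructor
  · intro hJ g hg
    obtain ⟨z, hz⟩ := hg _ hJ
    refine ⟨z, ?_⟩
    rw [← hz, mulVec_mulVec, mul_nonsing_inv A hA, one_mulVec]
    simp [dotProduct]
  · contrapose!
    intro hJ
    let f : (Fin N → ℤ) →+ (Fin N → ℚ) :=
      A⁻¹.mulVecLin.toAddMonoidHom.comp ((Int.castAddHom ℚ).compLeft (Fin N))
    have hf (x : Fin N → ℤ) : f x = A⁻¹.mulVec (fun i => (x i : ℚ)) := rfl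
    have h1 : (fun _ => 1) ∉ L.comap f := by
      rw [AddSubgroup.mem_comap, hf]
      simpa using hJ
    obtain ⟨g, hg, hg1⟩ := exists_rat_covector_separating _ h1
    refine ⟨g, fun b hb => ?_, fun z hz => hg1 ⟨z, by simpa [dotProduct] using hz⟩⟩
    choose y hy using hML b hb
    rw [funext hy]
    refine hg y ?_
    rw [AddSubgroup.mem_comap, hf, ← funext hy, mulVec_mulVec, nonsing_inv_mul A hA, one_mulVec]
    exact hb
end
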